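/- Let (Ω, F, μ) be a probability space, let Y, M, R, C be measurable sets, and let B_maj, B_min be measurable conditioning events such that for each d ∈ {maj, min}: μ(B_d) > 0, μ(C ∩ B_d) > 0, μ(Cᶜ ∩ B_d) > 0, μ(R ∩ B_d) > 0, μ(R ∩ C ∩ B_d) > 0 and μ(R ∩ Cᶜ ∩ B_d) > 0. Assume criminality is independent of race given context: P[C ∣ B_maj] = P[C ∣ B_min]. If observational parity in law enforcement is violated, i.e. P[Y ∩ M ∣ R ∩ B_maj] ≠ P[Y ∩ M ∣ R ∩ B_min], then it is NOT the case that all four of the following parity equalities hold simultaneously: P[Y ∩ M ∣ R ∩ C ∩ B_maj] = P[Y ∩ M ∣ R ∩ C ∩ B_min], P[Y ∩ M ∣ R ∩ Cᶜ ∩ B_maj] = P[Y ∩ M ∣ R ∩ Cᶜ ∩ B_min], P[R ∣ C ∩ B_maj] = P[R ∣ C ∩ B_min], and P[R ∣ Cᶜ ∩ B_maj] = P[R ∣ Cᶜ ∩ B_min]. (This is the paper's Theorem in Section 2.4: violation of observational parity in a context u implies there cannot be parity in law enforcement and reporting simultaneously in that context.) -/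

import Mathlib

open MeasureTheory ProbabilityTheory Filter

/-- Conditional probability `P[A ∣ B] = μ(A ∩ B)/μ(B)` as a real number,
via Mathlib's `ProbabilityTheory.cond`. -/
noncomputable def condP {Ω : Type*} [MeasurableSpace Ω] (μ : Measure Ω) (A B : Set Ω) : ℝ :=
  ((ProbabilityTheory.cond μ B) A).toReal

section condP

variable {Ω : Type*} [MeasurableSpace Ω] (μ : Measure Ω) {A B C R : Set Ω}

lemma condP_eq_div (hB : MeasurableSet B) (A : Set Ω) :
    condP μ A B = μ.real (A ∩ B) / μ.real B := by
  rw [condP, cond_apply hB, ENNReal.toReal_mul, ENNReal.toReal_inv, Set.inter_comm B A,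
    div_eq_inv_mul, measureReal_def, measureReal_def]

variable [IsFiniteMeasure μ]

/-- The chain rule for conditional probabilities. -/
lemma condP_inter (hR : MeasurableSet R) (hB : MeasurableSet B) (A : Set Ω) :
    condP μ (A ∩ R) B = condP μ A (R ∩ B) * condP μ R B := by
  rw [condP_eq_div μ hB, condP_eq_div μ (hR.inter hB), condP_eq_div μ hB, Set.inter_assoc]
  by_cases h : μ.real (R ∩ B) = 0
  · have : μ.real (A ∩ (R ∩ B)) = 0 :=
      le_antisymm (h ▸ measureReal_mono Set.inter_subset_right) measureReal_nonneg
    simp [h, this]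
  · field_simp

/-- The law of total probability, conditionally on `B`. -/
lemma condP_total (hC : MeasurableSet C) (hB : MeasurableSet B) (A : Set Ω) :
    condP μ A B = condP μ A (C ∩ B) * condP μ C B + condP μ A (Cᶜ ∩ B) * condP μ Cᶜ B := by
  rw [← condP_inter μ hC hB, ← condP_inter μ hC.compl hB, condP_eq_div μ hB, condP_eq_div μ hB,
    condP_eq_div μ hB, ← add_div, ← measureReal_inter_add_sdiff (μ := μ) (s := A ∩ B) hC,
    Set.sdiff_eq, Set.inter_right_comm A B C, Set.inter_right_comm A B Cᶜ]

lemma condP_compl (hC : MeasurableSet C) (hpos : 0 < μ B) :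
    condP μ Cᶜ B = 1 - condP μ C B := by
  have := cond_isProbabilityMeasure (μ := μ) hpos.ne'
  exact probReal_compl_eq_one_sub (μ := cond μ B) hC

lemma condP_pos (hB : MeasurableSet B) (hpos : 0 < μ (R ∩ B)) : 0 < condP μ R B := by
  rw [condP_eq_div μ hB]
  have h : 0 < μ.real (R ∩ B) := ENNReal.toReal_pos hpos.ne' (measure_ne_top μ _)
  exact div_pos h (h.trans_le (measureReal_mono Set.inter_subset_right))

/-- The conditional probability given `R ∩ B` in terms of those given `C` and given `Cᶜ`. -/
lemma condP_inter_right_eq_div (hR : MeasurableSet R) (hC : MeasurableSet C)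
    (hB : MeasurableSet B) (hBpos : 0 < μ B) (hRB : 0 < μ (R ∩ B)) (A : Set Ω) :
    condP μ A (R ∩ B) =
      (condP μ A (R ∩ C ∩ B) * condP μ R (C ∩ B) * condP μ C B +
        condP μ A (R ∩ Cᶜ ∩ B) * condP μ R (Cᶜ ∩ B) * (1 - condP μ C B)) /
      (condP μ R (C ∩ B) * condP μ C B + condP μ R (Cᶜ ∩ B) * (1 - condP μ C B)) := by
  rw [Set.inter_assoc R C, Set.inter_assoc R Cᶜ, ← condP_inter μ hR (hC.inter hB),
    ← condP_inter μ hR (hC.compl.inter hB), ← condP_compl μ hC hBpos,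
    ← condP_total μ hC hB, ← condP_total μ hC hB, condP_inter μ hR hB,
    mul_div_cancel_right₀ _ (condP_pos μ hB hRB).ne']

end condP

theorem stmt5 {Ω : Type*} [MeasurableSpace Ω] (μ : Measure Ω) [IsProbabilityMeasure μ]
    (Y M R C Bmaj Bmin : Set Ω)
    (hYm : MeasurableSet Y) (hMm : MeasurableSet M) (hRm : MeasurableSet R)
    (hCm : MeasurableSet C) (hBmajm : MeasurableSet Bmaj) (hBminm : MeasurableSet Bmin)
    (hBmaj : 0 < μ Bmaj) (hCBmaj : 0 < μ (C ∩ Bmaj)) (hCcBmaj : 0 < μ (Cᶜ ∩ Bmaj))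
    (hRBmaj : 0 < μ (R ∩ Bmaj)) (hRCBmaj : 0 < μ (R ∩ C ∩ Bmaj)) (hRCcBmaj : 0 < μ (R ∩ Cᶜ ∩ Bmaj))
    (hBmin : 0 < μ Bmin) (hCBmin : 0 < μ (C ∩ Bmin)) (hCcBmin : 0 < μ (Cᶜ ∩ Bmin))
    (hRBmin : 0 < μ (R ∩ Bmin)) (hRCBmin : 0 < μ (R ∩ C ∩ Bmin)) (hRCcBmin : 0 < μ (R ∩ Cᶜ ∩ Bmin))
    (hCD : condP μ C Bmaj = condP μ C Bmin)
    (hObs : condP μ (Y ∩ M) (R ∩ Bmaj) ≠ condP μ (Y ∩ M) (R ∩ Bmin)) :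
    ¬ (condP μ (Y ∩ M) (R ∩ C ∩ Bmaj) = condP μ (Y ∩ M) (R ∩ C ∩ Bmin)
        ∧ condP μ (Y ∩ M) (R ∩ Cᶜ ∩ Bmaj) = condP μ (Y ∩ M) (R ∩ Cᶜ ∩ Bmin)
        ∧ condP μ R (C ∩ Bmaj) = condP μ R (C ∩ Bmin)
        ∧ condP μ R (Cᶜ ∩ Bmaj) = condP μ R (Cᶜ ∩ Bmin)) := by
  rintro ⟨hYC, hYCc, hRC, hRCc⟩
  apply hObs
  rw [condP_inter_right_eq_div μ hRm hCm hBmajm hBmaj hRBmaj,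
    condP_inter_right_eq_div μ hRm hCm hBminm hBmin hRBmin, hYC, hYCc, hRC, hRCc, hCD]
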